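/- arXiv:1211.4390 — 2 statements merged into one kernel-verified Lean document; each statement's English description precedes it below -/
import Mathlib

section
/- Let H be a separable infinite-dimensional complex Hilbert space. Then the set of hypercyclic bounded linear operators on H is dense in B(H) with respect to the strong operator topology; equivalently, for every bounded operator T on H, every finite set of vectors x₁,…,x_k ∈ H and every ε > 0, there exists a hypercyclic bounded operator S on H with ‖S x_i − T x_i‖ < ε for i = 1,…,k. -/
open Filter Topology

/-- A continuous linear operator `T` is hypercyclic if some vector has dense orbit. -/
def Hypercyclic {𝕜 X : Type*} [Semiring 𝕜] [TopologicalSpace X] [AddCommMonoid X]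
    [Module 𝕜 X] (T : X →L[𝕜] X) : Prop :=
  ∃ x : X, Dense (Set.range fun n : ℕ => (T ^ n) x)

/-- An infinite-dimensional separable Hilbert space has a Hilbert basis indexed by `ℕ`. -/
theorem nonempty_hilbertBasis_nat {𝕜 H : Type*} [RCLike 𝕜] [NormedAddCommGroup H]
    [InnerProductSpace 𝕜 H] [CompleteSpace H] [TopologicalSpace.SeparableSpace H]
    (hdim : ¬FiniteDimensional 𝕜 H) : Nonempty (HilbertBasis ℕ 𝕜 H) := by
  obtain ⟨w, b, hb⟩ := exists_hilbertBasis 𝕜 H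
  have hsep : Pairwise fun x y : w => (1 : ℝ) ≤ dist x y := by
    intro x y hxy
    have h1 : inner 𝕜 (b x) (b x - b y) = 1 := by
      rw [inner_sub_right, b.orthonormal.inner_eq_zero hxy, inner_self_eq_norm_sq_to_K,
        b.orthonormal.norm_eq_one]
      simp
    have h2 := norm_inner_le_norm (𝕜 := 𝕜) (b x) (b x - b y)
    rw [h1, b.orthonormal.norm_eq_one, norm_one, one_mul, hb] at h2
    rwa [Subtype.dist_eq, dist_eq_norm]
  have : DiscreteTopology w := DiscreteTopology.of_forall_le_dist one_pos hsep
  have : SecondCountableTopology H := UniformSpace.secondCountable_of_separable H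
  have : Countable w := TopologicalSpace.separableSpace_iff_countable.1 inferInstance
  have : Infinite w := by
    by_contra hfin
    rw [not_infinite_iff_finite] at hfin
    have := Fintype.ofFinite w
    exact hdim b.toOrthonormalBasis.toBasis.finiteDimensional_of_finite
  obtain ⟨e⟩ : Nonempty (ℕ ≃ w) := inferInstance
  refine ⟨HilbertBasis.mk (b.orthonormal.comp e e.injective) ?_⟩
  rw [EquivLike.range_comp b e]
  exact b.dense_span.ge

/-- **Birkhoff's transitivity theorem**: a topologically transitive operator on a separable
Banach space is hypercyclic. -/
theorem hypercyclic_of_transitive {𝕜 X : Type*} [NontriviallyNormedField 𝕜]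
    [NormedAddCommGroup X] [NormedSpace 𝕜 X] [CompleteSpace X] [TopologicalSpace.SeparableSpace X]
    (T : X →L[𝕜] X) (hT : ∀ U V : Set X, IsOpen U → IsOpen V → U.Nonempty → V.Nonempty →
      ∃ n : ℕ, ∃ x ∈ U, (T ^ n) x ∈ V) : Hypercyclic T := by
  have : SecondCountableTopology X := UniformSpace.secondCountable_of_separable X
  let B := TopologicalSpace.countableBasis X
  have hB : TopologicalSpace.IsTopologicalBasis B := TopologicalSpace.isBasis_countableBasis X
  have : Countable B := (TopologicalSpace.countable_countableBasis X).to_subtype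
  have hd : Dense (⋂ V : B, ⋃ n : ℕ, (T ^ n) ⁻¹' (V : Set X)) := by
    refine dense_iInter_of_isOpen
      (fun V => isOpen_iUnion fun n => (hB.isOpen V.2).preimage (T ^ n).continuous) fun V => ?_
    refine dense_iff_inter_open.2 fun U hU hUne => ?_
    obtain ⟨n, x, hxU, hxV⟩ := hT U V hU (hB.isOpen V.2) hUne
      (TopologicalSpace.nonempty_of_mem_countableBasis V.2)
    exact ⟨x, hxU, Set.mem_iUnion.2 ⟨n, hxV⟩⟩
  obtain ⟨x, hx⟩ := hd.nonempty
  refine ⟨x, hB.dense_iff.2 fun V hV _ => ?_⟩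
  obtain ⟨n, hn⟩ := Set.mem_iUnion.1 (Set.mem_iInter.1 hx ⟨V, hV⟩)
  exact ⟨_, hn, n, rfl⟩

/-- **Kitai's hypercyclicity criterion**, with a right inverse defined everywhere. -/
theorem hypercyclic_of_tendsto_zero {𝕜 X : Type*} [NontriviallyNormedField 𝕜]
    [NormedAddCommGroup X] [NormedSpace 𝕜 X] [CompleteSpace X] [TopologicalSpace.SeparableSpace X]
    (T Q : X →L[𝕜] X) (hTQ : T * Q = 1) {D : Set X} (hD : Dense D)
    (hT : ∀ x ∈ D, Tendsto (fun n : ℕ => (T ^ n) x) atTop (𝓝 0))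
    (hQ : ∀ x ∈ D, Tendsto (fun n : ℕ => (Q ^ n) x) atTop (𝓝 0)) : Hypercyclic T := by
  refine hypercyclic_of_transitive T fun U V hU hV hUne hVne => ?_
  obtain ⟨x, hxD, hxU⟩ := hD.exists_mem_open hU hUne
  obtain ⟨y, hyD, hyV⟩ := hD.exists_mem_open hV hVne
  have h1 : Tendsto (fun n : ℕ => x + (Q ^ n) y) atTop (𝓝 x) := by
    simpa using (hQ y hyD).const_add x
  have h2 : Tendsto (fun n : ℕ => (T ^ n) (x + (Q ^ n) y)) atTop (𝓝 y) := by
    have hpow : ∀ n : ℕ, (T ^ n) ((Q ^ n) y) = y := fun n => by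
      rw [← mul_apply_eq_comp, pow_mul_pow_eq_one n hTQ]
      rfl
    simpa only [map_add, hpow, zero_add] using (hT x hxD).add_const y
  obtain ⟨n, hn1, hn2⟩ :=
    ((h1.eventually_mem (hU.mem_nhds hxU)).and (h2.eventually_mem (hV.mem_nhds hyV))).exists
  exact ⟨n, _, hn1, hn2⟩

/-- Hypercyclicity is invariant under similarity. -/
theorem Hypercyclic.conj {𝕜 X : Type*} [NontriviallyNormedField 𝕜]
    [NormedAddCommGroup X] [NormedSpace 𝕜 X] {R : X →L[𝕜] X} (hR : Hypercyclic R)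
    (A : X ≃L[𝕜] X) :
    Hypercyclic ((A : X →L[𝕜] X) * R * (A.symm : X →L[𝕜] X)) := by
  obtain ⟨x, hx⟩ := hR
  refine ⟨A x, ?_⟩
  have hpow : ∀ n : ℕ, (((A : X →L[𝕜] X) * R * (A.symm : X →L[𝕜] X)) ^ n) (A x)
      = A ((R ^ n) x) := by
    intro n
    induction n with
    | zero => simp
    | succ n ih => simp [pow_succ', ih]
  simp_rw [hpow]
  exact A.surjective.denseRange.comp hx A.continuous

/-- **Rolewicz's theorem**: twice the backward shift along a Hilbert basis is hypercyclic. -/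
theorem HilbertBasis.exists_hypercyclic_shift {𝕜 H : Type*} [RCLike 𝕜] [NormedAddCommGroup H]
    [InnerProductSpace 𝕜 H] [CompleteSpace H] [TopologicalSpace.SeparableSpace H]
    (b : HilbertBasis ℕ 𝕜 H) :
    ∃ R : H →L[𝕜] H, Hypercyclic R ∧ ∀ n, R (b (n + 1)) = (2 : 𝕜) • b n := by
  have hsucc : Orthonormal 𝕜 fun n => b (n + 1) :=
    b.orthonormal.comp _ (add_left_injective 1)
  let V : H →ₗᵢ[𝕜] H := hsucc.orthogonalFamily.linearIsometry.comp b.repr.toLinearIsometry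
  have hV : ∀ n, V (b n) = b (n + 1) := fun n => by
    simp [V, b.repr_self, OrthogonalFamily.linearIsometry_apply_single]
  let L : H →L[𝕜] H := ContinuousLinearMap.adjoint V.toContinuousLinearMap
  have hLV : L * V.toContinuousLinearMap = 1 := V.adjoint_comp_self
  have hL : ∀ n, L (b (n + 1)) = b n := fun n => by
    rw [← hV]
    exact DFunLike.congr_fun hLV (b n)
  have hL0 : L (b 0) = 0 := by
    refine b.repr.injective ?_
    ext n
    rw [b.repr_apply_apply, ContinuousLinearMap.adjoint_inner_right]
    simp [hV, b.orthonormal.inner_eq_zero]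
  refine ⟨(2 : 𝕜) • L, ?_, fun n => by simp [hL]⟩
  have hzero : ∀ k n, k < n → (((2 : 𝕜) • L) ^ n) (b k) = 0 := by
    intro k
    induction k with
    | zero =>
      intro n hn
      obtain ⟨n, rfl⟩ := Nat.exists_eq_succ_of_ne_zero hn.ne'
      rw [pow_succ, mul_apply_eq_comp, smul_apply, hL0, smul_zero, map_zero]
    | succ k ih =>
      intro n hn
      obtain ⟨n, rfl⟩ := Nat.exists_eq_succ_of_ne_zero (Nat.ne_zero_of_lt hn)
      rw [pow_succ, mul_apply_eq_comp, smul_apply, hL, map_smul,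
        ih n (by omega), smul_zero]
  have hdense : Dense (Submodule.span 𝕜 (Set.range b) : Set H) :=
    Submodule.dense_iff_topologicalClosure_eq_top.2 b.dense_span
  refine hypercyclic_of_tendsto_zero _ ((2 : 𝕜)⁻¹ • V.toContinuousLinearMap) ?_ hdense ?_ ?_
  · rw [smul_mul_smul_comm, hLV, mul_inv_cancel₀ two_ne_zero, one_smul]
  · intro x hx
    induction hx using Submodule.span_induction with
    | mem x hx =>
      obtain ⟨k, rfl⟩ := hx
      refine tendsto_const_nhds.congr' ?_
      filter_upwards [eventually_gt_atTop k] with n hn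
      exact (hzero k n hn).symm
    | zero => simpa only [map_zero] using tendsto_const_nhds
    | add x y _ _ hx hy => simpa only [map_add, add_zero] using hx.add hy
    | smul c x _ hx => simpa only [map_smul, smul_zero] using hx.const_smul c
  · intro x _
    have hnorm : ∀ n : ℕ,
        ‖(((2 : 𝕜)⁻¹ • V.toContinuousLinearMap) ^ n) x‖ = (2⁻¹ : ℝ) ^ n * ‖x‖ := by
      intro n
      induction n with
      | zero => simp
      | succ n ih =>
        rw [pow_succ', mul_apply_eq_comp, smul_apply, norm_smul,
          LinearIsometry.coe_toContinuousLinearMap, V.norm_map, ih]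
        simp [pow_succ', mul_assoc]
    rw [tendsto_zero_iff_norm_tendsto_zero]
    simp_rw [hnorm]
    simpa using (tendsto_pow_atTop_nhds_zero_of_lt_one (r := (2⁻¹ : ℝ)) (by norm_num)
      (by norm_num)).mul_const ‖x‖

/-- In an infinite-dimensional space, any finite family can be perturbed to a linearly independent
one whose span is disjoint from a given finite-dimensional subspace. -/
theorem exists_linearIndependent_near {𝕜 X : Type*} [RCLike 𝕜] [NormedAddCommGroup X]
    [NormedSpace 𝕜 X] (hdim : ¬FiniteDimensional 𝕜 X) {ε : ℝ} (hε : 0 < ε) {k : ℕ} (t : Fin k → X)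
    (W : Submodule 𝕜 X) [FiniteDimensional 𝕜 W] :
    ∃ w : Fin k → X, (∀ i, ‖w i - t i‖ < ε) ∧ LinearIndependent 𝕜 w ∧
      Disjoint (Submodule.span 𝕜 (Set.range w)) W := by
  induction k generalizing W with
  | zero => exact ⟨t, fun i => i.elim0, linearIndependent_empty_type, by simp⟩
  | succ k ih =>
    have hW : W ≠ ⊤ := by
      rintro rfl
      exact hdim (Module.Finite.equiv (Submodule.topEquiv (R := 𝕜) (M := X)))
    obtain ⟨a, hat, haW⟩ : ∃ a ∈ Metric.ball (t 0) ε, a ∉ W := by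
      by_contra! h
      exact hW (W.eq_top_of_nonempty_interior'
        ⟨t 0, mem_interior.2 ⟨_, h, Metric.isOpen_ball, Metric.mem_ball_self hε⟩⟩)
    obtain ⟨w, hwt, hw, hwd⟩ := ih (fun i => t i.succ) (Submodule.span 𝕜 {a} ⊔ W)
    refine ⟨Fin.cons a w, Fin.cases (mem_ball_iff_norm.1 hat) hwt,
      linearIndependent_finCons.2 ⟨hw, fun ha => ?_⟩, ?_⟩
    · have ha' : a ∈ Submodule.span 𝕜 {a} ⊔ W :=
        Submodule.mem_sup_left (Submodule.mem_span_singleton_self a)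
      exact haW (Submodule.disjoint_def.1 hwd a ha ha' ▸ W.zero_mem)
    · rw [Fin.range_cons, Submodule.span_insert, sup_comm]
      refine Disjoint.disjoint_sup_left_of_disjoint_sup_right ?_ hwd
      rw [disjoint_comm, Submodule.disjoint_span_singleton]
      exact fun ha => absurd ha haW

/-- A finite linearly independent family admits a biorthogonal family of continuous functionals. -/
theorem LinearIndependent.exists_biorthogonal {𝕜 X ι : Type*} [RCLike 𝕜] [NormedAddCommGroup X]
    [NormedSpace 𝕜 X] [Fintype ι] [DecidableEq ι] {v : ι → X} (hv : LinearIndependent 𝕜 v) :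
    ∃ f : ι → X →L[𝕜] 𝕜, ∀ i j, f i (v j) = if j = i then 1 else 0 := by
  have hsurj := SeparatingDual.dualMap_surjective_iff.2 hv.fintypeLinearCombination_injective
  choose f hf using fun i => hsurj (LinearMap.proj i)
  refine ⟨f, fun i j => ?_⟩
  simpa [Fintype.linearCombination_apply_single, Pi.single_apply, eq_comm]
    using DFunLike.congr_fun (hf i) (Pi.single j 1)

/-- Two finite families that are jointly linearly independent are exchanged by an invertible
operator. -/
theorem exists_continuousLinearEquiv_of_linearIndependent_sum {𝕜 X ι : Type*} [RCLike 𝕜]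
    [NormedAddCommGroup X] [NormedSpace 𝕜 X] [Fintype ι] {u v : ι → X}
    (h : LinearIndependent 𝕜 (Sum.elim u v)) : ∃ A : X ≃L[𝕜] X, ∀ i, A (u i) = v i := by
  classical
  obtain ⟨f, hf⟩ := h.exists_biorthogonal
  let P : X →L[𝕜] X := ∑ i, (f (.inl i) - f (.inr i)).smulRight (v i - u i)
  have hP : ∀ x, P x = ∑ i, (f (.inl i) x - f (.inr i) x) • (v i - u i) := fun x => by
    simp [P]
  have hu : ∀ i, P (u i) = v i - u i := fun i => by
    have h1 : ∀ j, f (.inl j) (u i) = if i = j then 1 else 0 := fun j => by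
      simpa using hf (.inl j) (.inl i)
    have h2 : ∀ j, f (.inr j) (u i) = 0 := fun j => by simpa using hf (.inr j) (.inl i)
    simp [hP, h1, h2]
  have hv : ∀ i, P (v i) = -(v i - u i) := fun i => by
    have h1 : ∀ j, f (.inr j) (v i) = if i = j then 1 else 0 := fun j => by
      simpa using hf (.inr j) (.inr i)
    have h2 : ∀ j, f (.inl j) (v i) = 0 := fun j => by simpa using hf (.inl j) (.inr i)
    simp [hP, h1, h2]
  have hPP : ∀ x, P (P x) = -(2 : 𝕜) • P x := fun x => by
    rw [hP x, map_sum, Finset.smul_sum]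
    refine Finset.sum_congr rfl fun i _ => ?_
    rw [map_smul, map_sub, hu, hv]
    module
  have hinv : Function.LeftInverse (1 + P : X →L[𝕜] X) (1 + P : X →L[𝕜] X) := fun x => by
    simp only [add_apply, one_apply_eq_self, map_add, hPP]
    module
  exact ⟨.equivOfInverse (1 + P) (1 + P) hinv hinv, fun i => by simp [hu]⟩

/-- In an infinite-dimensional space, the invertible operators act transitively on linearly
independent families of a given finite length. -/
theorem exists_continuousLinearEquiv_of_linearIndependent {𝕜 X : Type*} [RCLike 𝕜]
    [NormedAddCommGroup X] [NormedSpace 𝕜 X] (hdim : ¬FiniteDimensional 𝕜 X) {ι : Type*}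
    [Fintype ι] {u v : ι → X} (hu : LinearIndependent 𝕜 u) (hv : LinearIndependent 𝕜 v) :
    ∃ A : X ≃L[𝕜] X, ∀ i, A (u i) = v i := by
  have := FiniteDimensional.span_of_finite 𝕜 (Set.finite_range u)
  have := FiniteDimensional.span_of_finite 𝕜 (Set.finite_range v)
  obtain ⟨w', -, hw', hd'⟩ := exists_linearIndependent_near hdim one_pos
    (fun _ : Fin (Fintype.card ι) => (0 : X))
    (Submodule.span 𝕜 (Set.range u) ⊔ Submodule.span 𝕜 (Set.range v))
  let e := Fintype.equivFin ι
  have hw : LinearIndependent 𝕜 (w' ∘ e) := hw'.comp e e.injective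
  rw [← EquivLike.range_comp w' e] at hd'
  obtain ⟨A, hA⟩ := exists_continuousLinearEquiv_of_linearIndependent_sum
    (hu.sum_type hw (hd'.mono_right le_sup_left).symm)
  obtain ⟨B, hB⟩ := exists_continuousLinearEquiv_of_linearIndependent_sum
    (hw.sum_type hv (hd'.mono_right le_sup_right))
  exact ⟨A.trans B, fun i => (congrArg B (hA i)).trans (hB i)⟩

/-- Any linearly independent family and any values on it can be approximately interpolated by a
hypercyclic operator. -/
theorem exists_hypercyclic_near_of_linearIndependent {𝕜 H : Type*} [RCLike 𝕜]
    [NormedAddCommGroup H] [InnerProductSpace 𝕜 H] [CompleteSpace H]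
    [TopologicalSpace.SeparableSpace H] (hdim : ¬FiniteDimensional 𝕜 H) {m : ℕ} {x : Fin m → H}
    (hx : LinearIndependent 𝕜 x) (t : Fin m → H) {ε : ℝ} (hε : 0 < ε) :
    ∃ S : H →L[𝕜] H, Hypercyclic S ∧ ∀ i, ‖S (x i) - t i‖ < ε := by
  obtain ⟨b⟩ := nonempty_hilbertBasis_nat hdim
  obtain ⟨R, hR, hRb⟩ := b.exists_hypercyclic_shift
  have := FiniteDimensional.span_of_finite 𝕜 (Set.finite_range x)
  obtain ⟨z, hzt, hz, hd⟩ :=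
    exists_linearIndependent_near hdim hε t (Submodule.span 𝕜 (Set.range x))
  let g : Fin m ⊕ Fin m → ℕ := Sum.elim (fun i => 2 * i + 1) (fun i => 2 * i)
  have hg : Function.Injective g := by
    rintro (i | i) (j | j) h <;> simp only [g, Sum.elim_inl, Sum.elim_inr] at h
    · exact congrArg _ (Fin.ext (by omega))
    · omega
    · omega
    · exact congrArg _ (Fin.ext (by omega))
  have hy := (b.orthonormal.comp g hg).linearIndependent.units_smul
    (Sum.elim (fun _ => 1) fun _ => Units.mk0 2 two_ne_zero)
  obtain ⟨A, hA⟩ := exists_continuousLinearEquiv_of_linearIndependent hdim hy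
    (hx.sum_type hz hd.symm)
  have hAx : ∀ i : Fin m, A (b (2 * i + 1)) = x i := fun i => by simpa [g] using hA (.inl i)
  have hAz : ∀ i : Fin m, A ((2 : 𝕜) • b (2 * i)) = z i := fun i => by
    simpa [g, Units.smul_def] using hA (.inr i)
  refine ⟨_, hR.conj A, fun i => ?_⟩
  convert hzt i using 3
  rw [← hAz, ← hAx, ← hRb]
  simp

/-- Chan's theorem: on a separable infinite-dimensional complex Hilbert space, the
hypercyclic operators are dense in the strong operator topology: every bounded operator
can be approximated on any finite set of vectors by a hypercyclic operator. -/
theorem hypercyclic_dense_strong_operator_topology {H : Type*}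
    [NormedAddCommGroup H] [InnerProductSpace ℂ H] [CompleteSpace H]
    [TopologicalSpace.SeparableSpace H] (hdim : ¬FiniteDimensional ℂ H)
    (T : H →L[ℂ] H) (k : ℕ) (x : Fin k → H) (ε : ℝ) (hε : 0 < ε) :
    ∃ S : H →L[ℂ] H, Hypercyclic S ∧ ∀ i : Fin k, ‖S (x i) - T (x i)‖ < ε := by
  have := FiniteDimensional.span_of_finite ℂ (Set.finite_range x)
  let e := Module.finBasis ℂ (Submodule.span ℂ (Set.range x))
  let c := fun i => e.repr ⟨x i, Submodule.subset_span ⟨i, rfl⟩⟩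
  have hxc : ∀ i, x i = ∑ j, c i j • (e j : H) := fun i => by
    have h := congrArg Subtype.val (e.sum_repr ⟨x i, Submodule.subset_span ⟨i, rfl⟩⟩)
    rw [AddSubmonoidClass.coe_finsetSum] at h
    exact h.symm
  let C : ℝ := ∑ i, ∑ j, ‖c i j‖
  have hC : 0 ≤ C := Finset.sum_nonneg fun i _ => Finset.sum_nonneg fun j _ => norm_nonneg _
  have he : LinearIndependent ℂ fun j => (e j : H) :=
    e.linearIndependent.map' (Submodule.subtype _) (Submodule.ker_subtype _)
  obtain ⟨S, hS, hST⟩ := exists_hypercyclic_near_of_linearIndependent hdim he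
    (fun j => T (e j)) (ε := ε / (C + 1)) (by positivity)
  refine ⟨S, hS, fun i => ?_⟩
  have hdiff : S (x i) - T (x i) = ∑ j, c i j • (S (e j) - T (e j)) := by
    rw [hxc i]
    simp [smul_sub]
  calc ‖S (x i) - T (x i)‖ ≤ ∑ j, ‖c i j‖ * (ε / (C + 1)) := by
        rw [hdiff]
        refine norm_sum_le_of_le _ fun j _ => ?_
        rw [norm_smul]
        exact mul_le_mul_of_nonneg_left (hST j).le (norm_nonneg _)
    _ = (∑ j, ‖c i j‖) * (ε / (C + 1)) := (Finset.sum_mul ..).symm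
    _ ≤ C * (ε / (C + 1)) := by
        gcongr
        exact Finset.single_le_sum (f := fun i => ∑ j, ‖c i j‖)
          (fun i _ => Finset.sum_nonneg fun j _ => norm_nonneg _) (Finset.mem_univ i)
    _ < (C + 1) * (ε / (C + 1)) := by gcongr; linarith
    _ = ε := by field_simp
end

section
/- For every m-tuple (T₁,…,T_m) of pairwise commuting linear operators on ℂⁿ and every x ∈ ℂⁿ, the semigroup orbit {T₁^{k₁} ⋯ T_m^{k_m} x : k₁,…,k_m ≥ 0} is either dense in ℂⁿ or nowhere dense in ℂⁿ. -/
open Filter Topology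

theorem ContinuousLinearMap.eq_zero_of_nonneg_of_isPWO_image {E : Type*} [NormedAddCommGroup E]
    [NormedSpace ℝ E] {G : Set E} (f : E →L[ℝ] ℝ) (hG : (f '' G).IsPWO)
    (hpos : ∀ x ∈ G, 0 ≤ f x)
    (hint : (interior (closure (AddSubmonoid.closure G : Set E))).Nonempty) : f = 0 := by
  by_contra hf
  have hsurj : Function.Surjective f :=
    LinearMap.surjective (f := (f : E →ₗ[ℝ] ℝ)) fun h => hf (by ext x; exact LinearMap.congr_fun h x)
  have hopen : IsOpenMap f := f.isOpenMap_of_ne_zero hf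
  set D : Set ℝ := (AddSubmonoid.closure (f '' G) : Set ℝ) with hD
  have himage : f '' (AddSubmonoid.closure G : Set E) = D := by
    have := AddMonoidHom.map_mclosure (f : E →ₗ[ℝ] ℝ).toAddMonoidHom G
    exact congrArg (fun s : AddSubmonoid ℝ => (s : Set ℝ)) this
  have hDpwo : D.IsPWO := hG.addSubmonoid_closure (by rintro _ ⟨x, hx, rfl⟩; exact hpos x hx)
  set U := f '' interior (closure (AddSubmonoid.closure G : Set E)) with hU
  have hUo : IsOpen U := hopen _ isOpen_interior
  have hUD : U ⊆ closure D := by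
    rw [← himage]
    exact (Set.image_mono interior_subset).trans (image_closure_subset_closure_image f.continuous)
  obtain ⟨u, hu⟩ : U.Nonempty := hint.image f
  obtain ⟨δ, hδ, hball⟩ := Metric.isOpen_iff.1 hUo u hu
  rw [Real.ball_eq_Ioo] at hball
  have hmeet : ∀ a b, u - δ ≤ a → a < b → b ≤ u + δ → (D ∩ Set.Ioo a b).Nonempty := by
    intro a b ha hab hb
    obtain ⟨c, hc⟩ := Set.nonempty_Ioo.2 hab
    obtain ⟨d, hd, hdD⟩ := mem_closure_iff.1 (hUD (hball ⟨ha.trans_lt hc.1, hc.2.trans_le hb⟩)) _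
      isOpen_Ioo hc
    exact ⟨d, hdD, hd⟩
  have hne := hmeet (u - δ) (u + δ) le_rfl (by linarith) le_rfl
  have hwf : (D ∩ Set.Ioo (u - δ) (u + δ)).IsWF := (hDpwo.mono Set.inter_subset_left).isWF
  have hmin := hwf.min_mem hne
  obtain ⟨d, hdD, hd⟩ := hmeet (u - δ) (hwf.min hne) le_rfl hmin.2.1 hmin.2.2.le
  exact hwf.not_lt_min hne ⟨hdD, hd.1, hd.2.trans hmin.2.2⟩ hd.2

theorem neg_mem_of_neg_eq_sum_smul {E : Type*} [NormedAddCommGroup E] [NormedSpace ℝ E]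
    [ProperSpace E]
    {S : AddSubmonoid E} (hS : IsClosed (S : Set E)) {g : E} {ι : Type*} (F : Finset ι)
    (c : ι → ℝ) (hc : ∀ i ∈ F, 0 ≤ c i) (s : ι → E) (hs : ∀ i ∈ F, s i ∈ S)
    (hg : -g = ∑ i ∈ F, c i • s i) (hgS : g ∈ S) : -g ∈ S := by
  let v : ℕ → E := fun q => q • g + ∑ i ∈ F, ⌊q * c i⌋₊ • s i
  have hv : ∀ q, v q = -∑ i ∈ F, ((q * c i) - ⌊q * c i⌋₊) • s i := by
    intro q
    have hqg : q • g = -∑ i ∈ F, (q * c i) • s i := by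
      simp only [mul_smul, ← Finset.smul_sum, ← hg, smul_neg, neg_neg, Nat.cast_smul_eq_nsmul]
    simp only [v, hqg, sub_smul, Finset.sum_sub_distrib, Nat.cast_smul_eq_nsmul]
    abel
  have hbd : ∀ q, v q ∈ Metric.closedBall (0 : E) (∑ i ∈ F, ‖s i‖) := by
    intro q
    rw [mem_closedBall_zero_iff, hv, norm_neg]
    refine (norm_sum_le _ _).trans (Finset.sum_le_sum fun i hi => ?_)
    rw [norm_smul]
    refine mul_le_of_le_one_left (norm_nonneg _) ?_
    have h0 : 0 ≤ (q : ℝ) * c i := mul_nonneg q.cast_nonneg (hc i hi)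
    rw [Real.norm_eq_abs, abs_le]
    constructor <;> linarith [Nat.floor_le h0, Nat.lt_floor_add_one ((q : ℝ) * c i)]
  have hdiff : ∀ q r, q < r → v r - v q - g ∈ S := by
    intro q r hqr
    obtain ⟨k, rfl⟩ := Nat.exists_eq_add_of_lt hqr
    have hfl : ∀ i ∈ F, ⌊((q + k + 1 : ℕ) : ℝ) * c i⌋₊ • s i - ⌊(q : ℝ) * c i⌋₊ • s i ∈ S := by
      intro i hi
      have hle : ⌊(q : ℝ) * c i⌋₊ ≤ ⌊((q + k + 1 : ℕ) : ℝ) * c i⌋₊ :=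
        Nat.floor_mono (mul_le_mul_of_nonneg_right (by exact_mod_cast hqr.le) (hc i hi))
      rw [← Nat.sub_add_cancel hle, add_nsmul, add_sub_cancel_right]
      exact S.nsmul_mem (hs i hi) _
    have heq : v (q + k + 1) - v q - g = k • g +
        ∑ i ∈ F, (⌊((q + k + 1 : ℕ) : ℝ) * c i⌋₊ • s i - ⌊(q : ℝ) * c i⌋₊ • s i) := by
      simp only [v, Finset.sum_sub_distrib, add_nsmul, one_nsmul]
      abel
    rw [heq]
    exact S.add_mem (S.nsmul_mem hgS k) (S.sum_mem hfl)
  obtain ⟨a, -, φ, hφ, hlim⟩ := tendsto_subseq_of_bounded Metric.isBounded_closedBall hbd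
  have hlim' : Tendsto (fun n => v (φ (n + 1)) - v (φ n) - g) atTop (𝓝 (-g)) := by
    have := ((hlim.comp (tendsto_add_atTop_nat 1)).sub hlim).sub_const g
    simpa using this
  exact hS.mem_of_tendsto hlim' (Eventually.of_forall fun n => hdiff _ _ (hφ n.lt_succ_self))

/-- An additive submonoid of a finite-dimensional real space whose closure has nonempty interior is
dense, provided that it lies in no closed half-space. -/
theorem dense_addSubmonoid_of_nonempty_interior_closure {E : Type*} [NormedAddCommGroup E]
    [NormedSpace ℝ E] [FiniteDimensional ℝ E] (S : AddSubmonoid E)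
    (hS : ∀ f : E →L[ℝ] ℝ, (∀ x ∈ S, 0 ≤ f x) → f = 0)
    (hint : (interior (closure (S : Set E))).Nonempty) : Dense (S : Set E) := by
  have : ProperSpace E := FiniteDimensional.proper ℝ E
  let C : PointedCone ℝ E := PointedCone.hull ℝ (closure (S : Set E))
  have hconv : Convex ℝ (C : Set E) := PointedCone.convex C
  have hSC : closure (S : Set E) ⊆ C := PointedCone.subset_hull
  have hCint : (interior (C : Set E)).Nonempty := hint.mono (interior_mono hSC)
  have hCtop : ∀ p, p ∈ C := by
    intro p
    by_contra hp
    obtain ⟨f, hf⟩ := geometric_hahn_banach_open_point hconv.interior isOpen_interior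
      (fun h => hp (interior_subset h))
    have hle : ∀ x ∈ S, f x ≤ f p := fun x hx =>
      closure_minimal (fun a ha => (hf a ha).le) (isClosed_le f.continuous continuous_const)
        (hconv.closure_interior_eq_closure_of_nonempty_interior hCint ▸
          subset_closure (hSC (subset_closure hx)))
    have hnonpos : ∀ x ∈ S, 0 ≤ (-f) x := by
      intro x hx
      by_contra! hneg
      simp only [neg_apply, Left.neg_neg_iff] at hneg
      obtain ⟨n, hn⟩ := exists_lt_nsmul hneg (f p)
      have := hle (n • x) (S.nsmul_mem hx n)
      rw [map_nsmul] at this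
      exact absurd this hn.not_ge
    obtain ⟨a, ha⟩ := hCint
    have h := hf a ha
    rw [neg_eq_zero.1 (hS (-f) hnonpos)] at h
    exact lt_irrefl _ h
  have hneg : ∀ g ∈ S.topologicalClosure, -g ∈ S.topologicalClosure := by
    intro g hg
    obtain ⟨c, hcs, hc0, hc⟩ := PointedCone.mem_hull_set.1 (hCtop (-g))
    exact neg_mem_of_neg_eq_sum_smul S.isClosed_topologicalClosure c.support c
      (fun i _ => hc0 i) id (fun i hi => hcs hi) hc.symm hg
  let H : AddSubgroup E := { S.topologicalClosure with neg_mem' := fun {x} hx => hneg x hx }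
  have hHS : (H : Set E) = closure (S : Set E) := S.coe_topologicalClosure
  obtain ⟨g, hg⟩ := hint
  have hopen : IsOpen (H : Set E) :=
    H.isOpen_of_mem_nhds (g := g) (by rw [hHS]; exact mem_interior_iff_mem_nhds.1 hg)
  have hclopen : IsClopen (closure (S : Set E)) := ⟨isClosed_closure, hHS ▸ hopen⟩
  exact dense_iff_closure_eq.2 (hclopen.eq_univ ⟨0, subset_closure S.zero_mem⟩)

section CommutativeAlgebra

variable {A : Type*} [NormedCommRing A] [NormedAlgebra ℂ A] [FiniteDimensional ℂ A]

theorem countable_setOf_not_isUnit_one_add_smul (c : A) :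
    {z : ℂ | ¬ IsUnit (1 + z • c)}.Countable := by
  have hspec : (spectrum ℂ c).Finite := by
    refine (Module.End.finite_spectrum (Algebra.lmul ℂ A c)).subset ?_
    intro z hz hu
    apply hz
    rw [spectrum.mem_resolventSet_iff] at hu ⊢
    obtain ⟨y, hy⟩ := ((Module.End.isUnit_iff _).1 hu).2 1
    exact IsUnit.of_mul_eq_one y (by simpa [Algebra.smul_def, sub_mul] using hy)
  refine (((hspec.image fun w => -w⁻¹).insert 0).subset ?_).countable
  intro z hz
  rcases eq_or_ne z 0 with rfl | hz0
  · exact Set.mem_insert _ _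
  refine Set.mem_insert_of_mem _ ⟨-z⁻¹, fun hu => hz ?_, by simp⟩
  rw [spectrum.mem_resolventSet_iff] at hu
  have : 1 + z • c = (-z) • (algebraMap ℂ A (-z⁻¹) - c) := by
    rw [Algebra.algebraMap_eq_smul_one, smul_sub, smul_smul]
    simp [hz0]
  rw [this]
  exact hu.smul (Units.mk0 (-z) (neg_ne_zero.2 hz0))

theorem dense_setOf_isUnit : Dense {a : A | IsUnit a} := by
  intro b
  have hd : Dense {z : ℂ | IsUnit (1 + z • (b - 1))} := by
    have := (countable_setOf_not_isUnit_one_add_smul (b - 1)).dense_compl ℂ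
    simpa [Set.compl_def] using this
  have hcont : Continuous fun z : ℂ => 1 + z • (b - 1) := by fun_prop
  have hb := map_mem_closure (t := {a : A | IsUnit a}) hcont (hd 1) fun z hz => hz
  rwa [one_smul, add_sub_cancel] at hb

theorem isPreconnected_setOf_isUnit : IsPreconnected {a : A | IsUnit a} := by
  refine isPreconnected_of_forall 1 fun b hb => ?_
  have hconn := ((countable_setOf_not_isUnit_one_add_smul
    (b - 1)).isPathConnected_compl_of_one_lt_rank
    (by simp)).isConnected.isPreconnected
  refine ⟨_, ?_, ?_, ?_, hconn.image (fun z : ℂ => 1 + z • (b - 1)) (by fun_prop)⟩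
  · rintro _ ⟨z, hz, rfl⟩
    simpa using hz
  · exact ⟨0, by simp, by simp⟩
  · exact ⟨1, by simpa using hb, by simp⟩

theorem NormedSpace.isOpenMap_exp : IsOpenMap (exp : A → A) := by
  have : CompleteSpace A := FiniteDimensional.complete ℂ A
  let _ : NormedAlgebra ℚ A := NormedAlgebra.restrictScalars ℚ ℂ A
  refine IsOpenMap.of_nhds_le fun x => ?_
  refine ((hasStrictFDerivAt_exp (𝕂 := ℂ) (x := x)).map_nhds_eq_of_surj ?_).ge
  obtain ⟨u, hu⟩ := isUnit_exp x
  refine LinearMap.range_eq_top.2 fun y => ⟨(↑u⁻¹ : A) * y, ?_⟩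
  simp [← hu]

theorem NormedSpace.range_exp_eq_setOf_isUnit : Set.range (exp : A → A) = {a : A | IsUnit a} := by
  have : CompleteSpace A := FiniteDimensional.complete ℂ A
  let _ : NormedAlgebra ℚ A := NormedAlgebra.restrictScalars ℚ ℂ A
  refine Set.Subset.antisymm (Set.range_subset_iff.2 isUnit_exp) ?_
  by_contra hnot
  obtain ⟨b, hb, hbr⟩ := Set.not_subset.1 hnot
  let W : Set A := {a | IsUnit a ∧ a ∉ Set.range (exp : A → A)}
  have hW : IsOpen W := by
    rw [isOpen_iff_mem_nhds]
    rintro a ⟨⟨u, rfl⟩, har⟩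
    have hmem : (fun y : A => (↑u⁻¹ : A) * y) ⁻¹' Set.range (exp : A → A) ∈ 𝓝 (u : A) :=
      (isOpenMap_exp.isOpen_range.preimage (continuous_const_mul (↑u⁻¹ : A))).mem_nhds
        ⟨0, by simp⟩
    filter_upwards [hmem] with y ⟨x, hx⟩
    have hy : y = u * exp x := by rw [hx, Units.mul_inv_cancel_left]
    refine ⟨hy ▸ u.isUnit.mul (isUnit_exp x), ?_⟩
    rintro ⟨z, rfl⟩
    exact har ⟨z - x, by rw [sub_eq_add_neg, exp_add, hy, mul_assoc, ← exp_add]; simp⟩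
  obtain ⟨y, -, hy, hyW⟩ := isPreconnected_setOf_isUnit (A := A) _ W isOpenMap_exp.isOpen_range hW
    (fun a ha => or_iff_not_imp_left.2 fun h => ⟨ha, h⟩) ⟨exp 0, isUnit_exp 0, 0, rfl⟩
    ⟨b, hb, hb, hbr⟩
  exact hyW.2 hy

/-- In a finite-dimensional commutative complex algebra, a finitely generated multiplicative
submonoid whose closure has nonempty interior is dense. -/
theorem dense_submonoidClosure_of_nonempty_interior_closure {F : Set A} (hF : F.Finite)
    (hint : (interior (closure (Submonoid.closure F : Set A))).Nonempty) :
    Dense (Submonoid.closure F : Set A) := by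
  have : CompleteSpace A := FiniteDimensional.complete ℂ A
  let _ : NormedAlgebra ℚ A := NormedAlgebra.restrictScalars ℚ ℂ A
  let _ : NormedSpace ℝ A := NormedSpace.restrictScalars ℝ ℂ A
  have : FiniteDimensional ℝ A := FiniteDimensional.trans ℝ ℂ A
  let Λ : Set A := {a ∈ F | IsUnit a}
  have hlog : ∀ a ∈ Λ, ∃ l, NormedSpace.exp l = a := fun a ha => by
    have h : a ∈ Set.range (NormedSpace.exp : A → A) :=
      (NormedSpace.range_exp_eq_setOf_isUnit (A := A)).symm ▸ ha.2
    exact h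
  choose! l hl using hlog
  let K : Set A := {y | NormedSpace.exp y = 1}
  let G : Set A := K ∪ l '' Λ
  have hneg : ∀ y ∈ K, -y ∈ K := by
    intro y hy
    have : NormedSpace.exp (y + -y) = (1 : A) := by simp
    rwa [NormedSpace.exp_add, show NormedSpace.exp y = 1 from hy, one_mul] at this
  have hunit : ∀ x ∈ Submonoid.closure F, IsUnit x → x ∈ Submonoid.closure Λ := by
    intro x hx
    induction hx using Submonoid.closure_induction with
    | mem x hx => exact fun hu => Submonoid.subset_closure ⟨hx, hu⟩
    | one => exact fun _ => one_mem _
    | mul x y _ _ ihx ihy =>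
      intro hu
      exact mul_mem (ihx (isUnit_of_mul_isUnit_left hu)) (ihy (isUnit_of_mul_isUnit_right hu))
  have hlift : ∀ x ∈ Submonoid.closure Λ, ∃ y ∈ AddSubmonoid.closure G, NormedSpace.exp y = x := by
    intro x hx
    induction hx using Submonoid.closure_induction with
    | mem x hx => exact ⟨l x, AddSubmonoid.subset_closure (Or.inr ⟨x, hx, rfl⟩), hl x hx⟩
    | one => exact ⟨0, zero_mem _, NormedSpace.exp_zero⟩
    | mul x y _ _ ihx ihy =>
      obtain ⟨a, ha, rfl⟩ := ihx
      obtain ⟨b, hb, rfl⟩ := ihy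
      exact ⟨a + b, add_mem ha hb, NormedSpace.exp_add⟩
  have hexp : ∀ y ∈ AddSubmonoid.closure G, NormedSpace.exp y ∈ Submonoid.closure F := by
    intro y hy
    induction hy using AddSubmonoid.closure_induction with
    | mem y hy =>
      rcases hy with hy | ⟨a, ha, rfl⟩
      · rw [show NormedSpace.exp y = 1 from hy]
        exact one_mem _
      · rw [hl a ha]
        exact Submonoid.subset_closure ha.1
    | zero => simp
    | add x y _ _ ihx ihy => rw [NormedSpace.exp_add]; exact mul_mem ihx ihy
  have hpre : NormedSpace.exp ⁻¹' (Submonoid.closure F : Set A) ⊆ AddSubmonoid.closure G := by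
    intro y hy
    obtain ⟨z, hz, hzy⟩ := hlift _ (hunit _ hy (NormedSpace.isUnit_exp y))
    have hk : y - z ∈ K := by
      have h : NormedSpace.exp (y - z) * NormedSpace.exp z = 1 * NormedSpace.exp z := by
        rw [← NormedSpace.exp_add, sub_add_cancel, one_mul, hzy]
      exact (NormedSpace.isUnit_exp z).mul_right_cancel h
    rw [← sub_add_cancel y z]
    exact add_mem (AddSubmonoid.subset_closure (Or.inl hk)) hz
  have hGint : (interior (closure (AddSubmonoid.closure G : Set A))).Nonempty := by
    obtain ⟨a, haW, hau⟩ := (dense_setOf_isUnit (A := A)).inter_open_nonempty _ isOpen_interior hint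
    obtain ⟨y, rfl⟩ : a ∈ Set.range (NormedSpace.exp : A → A) :=
      (NormedSpace.range_exp_eq_setOf_isUnit (A := A)).symm ▸ hau
    refine ⟨y, interior_maximal ?_ (isOpen_interior.preimage NormedSpace.exp_continuous) haW⟩
    exact (Set.preimage_mono interior_subset).trans
      (NormedSpace.isOpenMap_exp.preimage_closure_subset_closure_preimage.trans
        (closure_mono hpre))
  have hGdense : Dense (AddSubmonoid.closure G : Set A) := by
    refine dense_addSubmonoid_of_nonempty_interior_closure _ (fun f hf => ?_) hGint
    have hG0 : ∀ x ∈ G, 0 ≤ f x := fun x hx => hf x (AddSubmonoid.subset_closure hx)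
    refine f.eq_zero_of_nonneg_of_isPWO_image (Set.Finite.isPWO ?_) hG0 hGint
    refine ((hF.image fun a => f (l a)).insert 0).subset ?_
    rintro _ ⟨x, hx | ⟨a, ha, rfl⟩, rfl⟩
    · have h1 := hG0 x (Or.inl hx)
      have h2 := hG0 (-x) (Or.inl (hneg x hx))
      rw [map_neg] at h2
      exact Or.inl (by linarith)
    · exact Or.inr ⟨a, ha.1, rfl⟩
  have hrange : DenseRange (NormedSpace.exp : A → A) := by
    rw [DenseRange, NormedSpace.range_exp_eq_setOf_isUnit]
    exact dense_setOf_isUnit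
  refine (hrange.dense_image NormedSpace.exp_continuous hGdense).mono ?_
  rintro _ ⟨y, hy, rfl⟩
  exact hexp y hy

end CommutativeAlgebra

/-- Feldman's dichotomy: for every tuple of pairwise commuting linear operators on `ℂⁿ`,
every semigroup orbit is either dense or nowhere dense. -/
theorem orbit_dense_or_nowhereDense (m n : ℕ) (T : Fin m → Module.End ℂ (Fin n → ℂ))
    (hcomm : ∀ i j, Commute (T i) (T j)) (x : Fin n → ℂ) :
    Dense {y : Fin n → ℂ | ∃ k : Fin m → ℕ, y = ((List.ofFn fun i => T i ^ k i).prod) x} ∨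
    IsNowhereDense
      {y : Fin n → ℂ | ∃ k : Fin m → ℕ, y = ((List.ofFn fun i => T i ^ k i).prod) x} := by
  refine or_iff_not_imp_right.2 fun hnd => ?_
  rw [IsNowhereDense, ← Ne, ← Set.nonempty_iff_ne_empty] at hnd
  let L : Fin m → ((Fin n → ℂ) →L[ℂ] (Fin n → ℂ)) := fun i => LinearMap.toContinuousLinearMap (T i)
  let A : Subalgebra ℂ ((Fin n → ℂ) →L[ℂ] (Fin n → ℂ)) := Algebra.adjoin ℂ (Set.range L)
  have hA : IsMulCommutative A := Algebra.isMulCommutative_adjoin ℂ <| by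
    rintro _ ⟨i, rfl⟩ _ ⟨j, rfl⟩
    ext1 y
    exact LinearMap.congr_fun (hcomm i j) y
  let _ : NormedCommRing A := { (inferInstance : NormedRing A) with
    mul_comm := fun a b => hA.is_comm.comm a b }
  let _ : NormedAlgebra ℂ A := { (inferInstance : Algebra ℂ A) with
    norm_smul_le := fun r a => norm_smul_le r (a : (Fin n → ℂ) →L[ℂ] (Fin n → ℂ)) }
  have : FiniteDimensional ℂ A := FiniteDimensional.finiteDimensional_subalgebra _
  let t : Fin m → A := fun i => ⟨L i, Algebra.subset_adjoin ⟨i, rfl⟩⟩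
  let ρ : A →* Module.End ℂ (Fin n → ℂ) :=
    { toFun := fun a => ((a : (Fin n → ℂ) →L[ℂ] (Fin n → ℂ)) : Module.End ℂ (Fin n → ℂ))
      map_one' := rfl
      map_mul' := fun _ _ => rfl }
  let ev : A →ₗ[ℂ] (Fin n → ℂ) :=
    { toFun := fun a => (a : (Fin n → ℂ) →L[ℂ] (Fin n → ℂ)) x
      map_add' := fun _ _ => rfl
      map_smul' := fun _ _ => rfl }
  have horbit : {y : Fin n → ℂ | ∃ k : Fin m → ℕ, y = ((List.ofFn fun i => T i ^ k i).prod) x} =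
      ev '' (Submonoid.closure (Set.range t) : Set A) := by
    have hprod : ∀ k : Fin m → ℕ,
        ((List.ofFn fun i => T i ^ k i).prod) x = ev (∏ i, t i ^ k i) := by
      intro k
      have h : (List.ofFn fun i => T i ^ k i).prod = ρ (∏ i, t i ^ k i) := by
        rw [← List.prod_ofFn, map_list_prod, List.map_ofFn]
        congr 2
        funext i
        exact (map_pow ρ (t i) (k i)).symm
      rw [h]
      rfl
    ext y
    constructor
    · rintro ⟨k, rfl⟩
      exact ⟨_, Submonoid.mem_closure_range_iff_of_fintype.2 ⟨k, rfl⟩, (hprod k).symm⟩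
    · rintro ⟨a, ha, rfl⟩
      obtain ⟨k, rfl⟩ := Submonoid.mem_closure_range_iff_of_fintype.1 ha
      exact ⟨k, (hprod k).symm⟩
  rw [horbit] at hnd ⊢
  have hsurj : Function.Surjective ev := by
    refine LinearMap.range_eq_top.1 (Submodule.eq_top_of_nonempty_interior' _ (hnd.mono ?_))
    refine interior_mono (closure_minimal ?_ (Submodule.closed_of_finiteDimensional _))
    rintro _ ⟨a, -, rfl⟩
    exact ⟨a, rfl⟩
  have hinj : Function.Injective ev := by
    refine (injective_iff_map_eq_zero ev).2 fun a ha => ?_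
    refine Subtype.ext (ContinuousLinearMap.ext fun y => ?_)
    obtain ⟨b, rfl⟩ := hsurj y
    have h : ev (a * b) = ev (b * a) := by rw [mul_comm]
    have hb : ev (b * a) = (b : (Fin n → ℂ) →L[ℂ] (Fin n → ℂ)) (ev a) := rfl
    rw [hb, ha, map_zero] at h
    exact h
  let e : A ≃L[ℂ] (Fin n → ℂ) :=
    (LinearEquiv.ofBijective ev ⟨hinj, hsurj⟩).toContinuousLinearEquiv
  have himage : ∀ s : Set A, ev '' s = e.toHomeomorph '' s := fun _ => rfl
  rw [himage] at hnd ⊢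
  rw [← e.toHomeomorph.image_closure, ← e.toHomeomorph.image_interior, Set.image_nonempty] at hnd
  exact e.toHomeomorph.surjective.denseRange.dense_image e.toHomeomorph.continuous
    (dense_submonoidClosure_of_nonempty_interior_closure (Set.finite_range t) hnd)
end
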